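/- arXiv:1507.02718 — 7 statements merged into one kernel-verified Lean document; each statement's English description precedes it below -/
import Mathlib

section
/- Let ν be a probability measure on [0,1] (the distribution of job qualities), let f : [0,1] → ℝ be nonnegative and nondecreasing, and let g : [0,1] → ℝ be nondecreasing, concave, and satisfy g(0) ≥ 0. Let κ be a Markov kernel from [0,1] to [0,1] (assigning to each job quality q a probability distribution κ_q of student abilities) such that the barycenter map β(q) = ∫ a dκ_q(a) is nondecreasing in q and satisfies ∫ β(q) dν(q) = 1/2. Then the social welfare satisfies ∫ f(q)·(∫ g(a) dκ_q(a)) dν(q) ≥ (1/2)·g(1)·∫ f(q) dν(q). Since the welfare of every Markov kernel from [0,1] to [0,1] is at most g(1)·∫ f dν, the welfare of κ is at least half the welfare of any assignment; i.e., the efficiency loss of matching is at most a factor of 2. -/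
open MeasureTheory Set ProbabilityTheory

/-- Chebyshev's association inequality for functions that vary together on a set of full
measure. -/
theorem MonovaryOn.integral_mul_integral_le {α : Type*} [MeasurableSpace α] {μ : Measure α}
    [IsProbabilityMeasure μ] {s : Set α} {f g : α → ℝ} (hfg : MonovaryOn f g s)
    (hs : ∀ᵐ x ∂μ, x ∈ s) (hf : Integrable f μ) (hg : Integrable g μ)
    (hmul : Integrable (fun x => f x * g x) μ) :
    (∫ x, f x ∂μ) * (∫ x, g x ∂μ) ≤ ∫ x, f x * g x ∂μ := by
  have key : ∀ y ∈ s, f y * (∫ x, g x ∂μ) + g y * (∫ x, f x ∂μ)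
      ≤ (∫ x, f x * g x ∂μ) + f y * g y := by
    intro y hy
    have h : ∫ x, (f y * g x + g y * f x) ∂μ ≤ ∫ x, (f x * g x + f y * g y) ∂μ := by
      refine integral_mono_ae ((hg.const_mul _).add (hf.const_mul _))
        (hmul.add (integrable_const _)) ?_
      filter_upwards [hs] with x hx
      have := monovaryOn_iff_forall_mul_nonneg.1 hfg hx hy
      linarith
    rw [integral_add (hg.const_mul _) (hf.const_mul _),
      integral_add hmul (integrable_const _)] at h
    simpa [integral_const_mul] using h
  have h : ∫ y, (f y * (∫ x, g x ∂μ) + g y * (∫ x, f x ∂μ)) ∂μ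
      ≤ ∫ y, ((∫ x, f x * g x ∂μ) + f y * g y) ∂μ := by
    refine integral_mono_ae ((hf.mul_const _).add (hg.mul_const _))
      ((integrable_const _).add hmul) ?_
    filter_upwards [hs] with y hy using key y hy
  rw [integral_add (hf.mul_const _) (hg.mul_const _),
    integral_add (integrable_const _) hmul, integral_mul_const, integral_mul_const] at h
  simp only [integral_const, probReal_univ, one_smul] at h
  linarith

/-- A function that is monotone on a compact interval carrying the whole measure is
integrable. -/
theorem MonotoneOn.integrable_of_ae_mem_Icc {μ : Measure ℝ} [IsFiniteMeasure μ] {a b : ℝ}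
    {f : ℝ → ℝ} (hf : MonotoneOn f (Icc a b)) (hμ : ∀ᵐ x ∂μ, x ∈ Icc a b) :
    Integrable f μ := by
  rw [← Measure.restrict_eq_self_of_ae_mem hμ]
  exact hf.integrableOn_isCompact isCompact_Icc

/-- On the unit interval, a concave function with `0 ≤ g 0` lies above the chord through the
origin. -/
theorem ConcaveOn.mul_le_of_mem_Icc {g : ℝ → ℝ} (hg : ConcaveOn ℝ (Icc (0 : ℝ) 1) g)
    (hg0 : 0 ≤ g 0) {a : ℝ} (ha : a ∈ Icc (0 : ℝ) 1) : g 1 * a ≤ g a := by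
  have h := hg.2 (left_mem_Icc.2 zero_le_one) (right_mem_Icc.2 zero_le_one)
    (sub_nonneg.2 ha.2) ha.1 (sub_add_cancel 1 a)
  simp only [smul_eq_mul, mul_zero, mul_one, zero_add] at h
  have := mul_nonneg (sub_nonneg.2 ha.2) hg0
  linarith

/-- The averages of a monotone function under the members of a kernel concentrated on `[a, b]`
form an a.e. strongly measurable function. -/
theorem MonotoneOn.aestronglyMeasurable_integral_kernel {α : Type*} [MeasurableSpace α]
    {μ : Measure α} {κ : Kernel α ℝ} [IsSFiniteKernel κ] {a b : ℝ} (hab : a ≤ b) {g : ℝ → ℝ}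
    (hg : MonotoneOn g (Icc a b)) (hκ : ∀ᵐ q ∂μ, ∀ᵐ x ∂κ q, x ∈ Icc a b) :
    AEStronglyMeasurable (fun q => ∫ x, g x ∂κ q) μ := by
  have hmono : Monotone (IccExtend hab (fun x : Icc a b => g x)) :=
    Monotone.IccExtend hab (fun x y hxy => hg x.2 y.2 hxy)
  have hmeas := hmono.measurable.stronglyMeasurable
  refine ⟨_, hmeas.integral_kernel (κ := κ), ?_⟩
  filter_upwards [hκ] with q hq
  refine integral_congr_ae ?_
  filter_upwards [hq] with x hx
  simp [IccExtend_of_mem hab _ hx]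

/-- For any assignment of students to jobs (a Markov kernel `κ` from job qualities in
`[0,1]` to student abilities in `[0,1]`) whose barycenter map is nondecreasing and has
`ν`-average `1/2`, the social welfare is at least `(1/2) * g 1 * ∫ f dν`, i.e. at least
half the welfare of any assignment: the efficiency loss is at most a factor of 2. -/
theorem stmt_2
    (ν : Measure ℝ) [IsProbabilityMeasure ν] (hν : ν (Set.Icc (0:ℝ) 1)ᶜ = 0)
    (f g : ℝ → ℝ)
    (hf0 : ∀ q ∈ Set.Icc (0:ℝ) 1, 0 ≤ f q)
    (hfmono : MonotoneOn f (Set.Icc (0:ℝ) 1))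
    (hgmono : MonotoneOn g (Set.Icc (0:ℝ) 1))
    (hgconc : ConcaveOn ℝ (Set.Icc (0:ℝ) 1) g)
    (hg0 : 0 ≤ g 0)
    (κ : Kernel ℝ ℝ) [IsMarkovKernel κ]
    (hκsupp : ∀ q ∈ Set.Icc (0:ℝ) 1, (κ q) (Set.Icc (0:ℝ) 1)ᶜ = 0)
    (hβmono : MonotoneOn (fun q => ∫ a, a ∂(κ q)) (Set.Icc (0:ℝ) 1))
    (hβavg : ∫ q, (∫ a, a ∂(κ q)) ∂ν = 1/2) :
    (1/2) * g 1 * (∫ q, f q ∂ν) ≤ ∫ q, f q * (∫ a, g a ∂(κ q)) ∂ν := by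
  have hνI : ∀ᵐ q ∂ν, q ∈ Icc (0 : ℝ) 1 := hν
  have hκI : ∀ q ∈ Icc (0 : ℝ) 1, ∀ᵐ a ∂κ q, a ∈ Icc (0 : ℝ) 1 := hκsupp
  have hβG : ∀ q ∈ Icc (0 : ℝ) 1, g 1 * (∫ a, a ∂κ q) ≤ ∫ a, g a ∂κ q := by
    intro q hq
    rw [← integral_const_mul]
    refine integral_mono_ae
      (((monotone_id.monotoneOn _).integrable_of_ae_mem_Icc (hκI q hq)).const_mul _)
      (hgmono.integrable_of_ae_mem_Icc (hκI q hq)) ?_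
    filter_upwards [hκI q hq] with a ha using hgconc.mul_le_of_mem_Icc hg0 ha
  have hGbound : ∀ q ∈ Icc (0 : ℝ) 1, ‖∫ a, g a ∂κ q‖ ≤ g 1 := by
    intro q hq
    have h : ∀ᵐ a ∂κ q, ‖g a‖ ≤ g 1 := by
      filter_upwards [hκI q hq] with a ha
      have h0 := hgmono (left_mem_Icc.2 zero_le_one) ha ha.1
      rw [Real.norm_of_nonneg (hg0.trans h0)]
      exact hgmono ha (right_mem_Icc.2 zero_le_one) ha.2
    simpa using norm_integral_le_of_norm_le_const h
  have hfint : Integrable f ν := hfmono.integrable_of_ae_mem_Icc hνI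
  have hβint : Integrable (fun q => ∫ a, a ∂κ q) ν := hβmono.integrable_of_ae_mem_Icc hνI
  have hfβint : Integrable (fun q => f q * ∫ a, a ∂κ q) ν := by
    have hβ0 : ∀ q ∈ Icc (0 : ℝ) 1, 0 ≤ ∫ a, a ∂κ q := fun q hq =>
      integral_nonneg_of_ae (by filter_upwards [hκI q hq] with a ha using ha.1)
    exact (hfmono.mul hβmono hf0 hβ0).integrable_of_ae_mem_Icc hνI
  have hfGint : Integrable (fun q => f q * ∫ a, g a ∂κ q) ν := by
    refine hfint.mul_bdd (c := g 1) ?_ ?_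
    · exact hgmono.aestronglyMeasurable_integral_kernel zero_le_one
        (by filter_upwards [hνI] with q hq using hκI q hq)
    · filter_upwards [hνI] with q hq using hGbound q hq
  have hcheb := (hfmono.monovaryOn hβmono).integral_mul_integral_le hνI hfint hβint hfβint
  rw [hβavg] at hcheb
  have hg1 : 0 ≤ g 1 := hg0.trans
    (hgmono (left_mem_Icc.2 zero_le_one) (right_mem_Icc.2 zero_le_one) zero_le_one)
  calc (1/2) * g 1 * (∫ q, f q ∂ν) = g 1 * ((∫ q, f q ∂ν) * (1/2)) := by ring
    _ ≤ g 1 * ∫ q, f q * (∫ a, a ∂κ q) ∂ν := mul_le_mul_of_nonneg_left hcheb hg1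
    _ = ∫ q, g 1 * (f q * (∫ a, a ∂κ q)) ∂ν := (integral_const_mul _ _).symm
    _ ≤ ∫ q, f q * (∫ a, g a ∂κ q) ∂ν := by
      refine integral_mono_ae (hfβint.const_mul _) hfGint ?_
      filter_upwards [hνI] with q hq
      have := mul_le_mul_of_nonneg_left (hβG q hq) (hf0 q hq)
      linarith
end

section
/- Let ν be a probability measure on [0,1], let g : [0,1] → ℝ be nonnegative and nondecreasing, and let T : [0,1] → [0,1] be a measurable map whose pushforward of ν is Lebesgue measure on [0,1]. Then ∫ q·g(T(q)) dν(q) ≤ ∫_0^1 g(a) da. Consequently, when the job-side welfare function f is the identity, the optimal welfare ∫ q·g(Q_T^{-1}(q)) dν(q) is at most 1/(∫ q dν) times the random-assignment welfare (∫ q dν)·(∫_0^1 g(a) da); so the price of anarchy is bounded by 1/avg(μ). -/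
open MeasureTheory Set

/-- If `T` pushes the job distribution `ν` forward to the uniform ability distribution
on `[0,1]` (the inverse of the truthful mapping), and `g` is nonnegative nondecreasing,
then the optimal welfare `∫ q·g(T q) dν` is at most `∫_0^1 g(a) da`. -/
theorem stmt_5
    (ν : Measure ℝ) [IsProbabilityMeasure ν] (hν : ν (Set.Icc (0:ℝ) 1)ᶜ = 0)
    (g T : ℝ → ℝ)
    (hg0 : ∀ a ∈ Set.Icc (0:ℝ) 1, 0 ≤ g a)
    (hgmono : MonotoneOn g (Set.Icc (0:ℝ) 1))
    (hT : Measurable T)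
    (hTmap : Set.MapsTo T (Set.Icc (0:ℝ) 1) (Set.Icc (0:ℝ) 1))
    (hTpush : Measure.map T ν = volume.restrict (Set.Icc (0:ℝ) 1)) :
    ∫ q, q * g (T q) ∂ν ≤ ∫ a in Set.Icc (0:ℝ) 1, g a := by
  have hg : Integrable g (Measure.map T ν) := by
    rw [hTpush]
    exact hgmono.integrableOn_isCompact isCompact_Icc
  have hsupp : ∀ᵐ q ∂ν, q ∈ Set.Icc (0:ℝ) 1 := hν
  rw [← hTpush, integral_map hT.aemeasurable hg.aestronglyMeasurable]
  refine integral_mono_of_nonneg ?_ (hg.comp_measurable hT) ?_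
  · filter_upwards [hsupp] with q hq
    exact mul_nonneg hq.1 (hg0 _ (hTmap hq))
  · filter_upwards [hsupp] with q hq
    exact mul_le_of_le_one_left (hg0 _ (hTmap hq)) hq.2
end

section
/- Let ν be a probability measure on [0,1] whose cumulative distribution function μ(q) = ν([0,q]) is continuous and strictly increasing on [0,1] with μ(0) = 0 and μ(1) = 1, and suppose that for every q' ∈ (0,1), ∫_{[0,q']} q dν(q) ≥ μ(q')·q'/2. Then 2·(∫_0^1 q dν(q))·(∫_0^1 q·μ(q) dν(q)) ≤ 1.36·∫_0^1 q² dν(q). -/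
open MeasureTheory Set

/-- A finite measure carried by `[0,1]` whose cumulative distribution function is continuous on
`[0,1]` and vanishes at `0` has no atoms. -/
lemma measureReal_singleton_eq_zero_of_continuousOn_cdf
    (ν : Measure ℝ) [IsFiniteMeasure ν] (hν : ν (Icc (0:ℝ) 1)ᶜ = 0)
    (hcont : ContinuousOn (fun q => ν.real (Icc 0 q)) (Icc (0:ℝ) 1))
    (h0 : ν.real (Icc (0:ℝ) 0) = 0) (q : ℝ) : ν.real {q} = 0 := by
  by_cases hq : q ∈ Icc (0:ℝ) 1
  · rcases hq.1.eq_or_lt with rfl | hpos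
    · simpa using h0
    have hle : ∀ r ∈ Ioo 0 q, ν.real {q} ≤ ν.real (Icc 0 q) - ν.real (Icc 0 r) := by
      intro r hr
      have hdisj : Disjoint (Icc 0 r) {q} := by
        rw [disjoint_singleton_right]
        exact fun h => absurd h.2 (not_le.mpr hr.2)
      have hsub : Icc 0 r ∪ {q} ⊆ Icc 0 q := by
        rintro x (hx | rfl)
        · exact ⟨hx.1, hx.2.trans hr.2.le⟩
        · exact ⟨hq.1, le_rfl⟩
      have hmono := measureReal_mono (μ := ν) hsub
      rw [measureReal_union hdisj (measurableSet_singleton q)] at hmono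
      linarith
    have hlim : Filter.Tendsto (fun r => ν.real (Icc 0 q) - ν.real (Icc 0 r))
        (nhdsWithin q (Ioo 0 q)) (nhds (ν.real (Icc 0 q) - ν.real (Icc 0 q))) :=
      tendsto_const_nhds.sub ((hcont q hq).mono_left
        (nhdsWithin_mono q fun r hr => ⟨hr.1.le, hr.2.le.trans hq.2⟩))
    rw [sub_self] at hlim
    have : (nhdsWithin q (Ioo 0 q)).NeBot := right_nhdsWithin_Ioo_neBot hpos
    exact le_antisymm (ge_of_tendsto hlim (eventually_mem_nhdsWithin.mono hle))
      measureReal_nonneg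
  · have : ν {q} = 0 := measure_mono_null (singleton_subset_iff.mpr hq) hν
    simp [measureReal_def, this]

/-- Integrating the truncated first moments of `ν` against `ν` weights each point by its
upper tail. -/
lemma integral_setIntegral_Icc_eq_integral_mul_tail
    (ν : Measure ℝ) [IsFiniteMeasure ν] (hpos : ∀ᵐ q ∂ν, 0 ≤ q)
    (hint : Integrable (fun q : ℝ => q) ν) :
    Integrable (fun y => ∫ x in Icc 0 y, x ∂ν) ν ∧
      ∫ y, (∫ x in Icc 0 y, x ∂ν) ∂ν = ∫ x, x * ν.real (Ici x) ∂ν := by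
  have hmeas : MeasurableSet {p : ℝ × ℝ | 0 ≤ p.2 ∧ p.2 ≤ p.1} :=
    (measurableSet_le measurable_const measurable_snd).inter
      (measurableSet_le measurable_snd measurable_fst)
  have hprod : Integrable
      (Function.uncurry fun y x : ℝ => (Icc 0 y).indicator (fun x => x) x) (ν.prod ν) := by
    refine ((hint.comp_snd ν).indicator hmeas).congr (Filter.Eventually.of_forall ?_)
    rintro ⟨y, x⟩
    simp [indicator, Function.uncurry]
  have hinner : ∀ y : ℝ, ∫ x, (Icc 0 y).indicator (fun x => x) x ∂ν = ∫ x in Icc 0 y, x ∂ν :=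
    fun y => integral_indicator measurableSet_Icc
  refine ⟨?_, ?_⟩
  · simpa only [Function.uncurry, hinner] using hprod.integral_prod_left
  · simp_rw [← hinner]
    rw [integral_integral_swap hprod]
    refine integral_congr_ae ?_
    filter_upwards [hpos] with x hx
    have : (fun y : ℝ => (Icc 0 y).indicator (fun x => x) x)
        = (Ici x).indicator fun _ => x := by
      ext y
      simp [indicator, hx]
    rw [this, integral_indicator measurableSet_Ici]
    simp [mul_comm]

/-- 1.36 price-of-anarchy bound for linear equilibria of the fully strategic grading
game: if the job distribution `ν` on `[0,1]` (with continuous strictly increasing CDF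
`μ`) satisfies `∫_{[0,q']} q dν ≥ μ(q')·q'/2` for all `q' ∈ (0,1)`, then
`2·(∫ q dν)·(∫ q·μ(q) dν) ≤ 1.36·∫ q² dν`. -/
theorem stmt_7
    (ν : Measure ℝ) [IsProbabilityMeasure ν] (hν : ν (Set.Icc (0:ℝ) 1)ᶜ = 0)
    (μ : ℝ → ℝ)
    (hμdef : ∀ q, μ q = (ν (Set.Icc 0 q)).toReal)
    (hμcont : ContinuousOn μ (Set.Icc (0:ℝ) 1))
    (hμmono : StrictMonoOn μ (Set.Icc (0:ℝ) 1))
    (hμ0 : μ 0 = 0) (hμ1 : μ 1 = 1)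
    (havg : ∀ q' ∈ Set.Ioo (0:ℝ) 1, μ q' * q' / 2 ≤ ∫ q in Set.Icc (0:ℝ) q', q ∂ν) :
    2 * (∫ q, q ∂ν) * (∫ q, q * μ q ∂ν) ≤ 1.36 * ∫ q, q ^ 2 ∂ν := by
  obtain rfl : μ = fun q => ν.real (Icc 0 q) := funext hμdef
  have hatom := measureReal_singleton_eq_zero_of_continuousOn_cdf ν hν hμcont hμ0
  have hmem : ∀ᵐ q ∂ν, q ∈ Icc (0:ℝ) 1 := hν
  have hne : ∀ a : ℝ, ∀ᵐ q ∂ν, q ≠ a := fun a => by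
    have h : ν {a} = 0 := (measureReal_eq_zero_iff).mp (hatom a)
    exact measure_eq_zero_iff_ae_notMem.mp h
  have hint : Integrable (fun q : ℝ => q) ν := by
    refine Integrable.of_bound measurable_id.aestronglyMeasurable 1 ?_
    filter_upwards [hmem] with q hq
    rw [Real.norm_eq_abs, abs_of_nonneg hq.1]
    exact hq.2
  have hint2 : Integrable (fun q : ℝ => q ^ 2) ν := by
    refine Integrable.of_bound (measurable_id.pow_const 2).aestronglyMeasurable 1 ?_
    filter_upwards [hmem] with q hq
    rw [Real.norm_eq_abs, abs_of_nonneg (sq_nonneg q)]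
    exact pow_le_one₀ hq.1 hq.2
  have hmono : Monotone fun q : ℝ => ν.real (Icc 0 q) :=
    fun a b hab => measureReal_mono (Icc_subset_Icc_right hab)
  have hintμ : Integrable (fun q : ℝ => q * ν.real (Icc 0 q)) ν := by
    refine hint.mul_bdd (c := 1) hmono.measurable.aestronglyMeasurable
      (Filter.Eventually.of_forall fun q => ?_)
    rw [Real.norm_eq_abs, abs_of_nonneg measureReal_nonneg]
    exact measureReal_le_one
  obtain ⟨hintF, hF⟩ :=
    integral_setIntegral_Icc_eq_integral_mul_tail ν (hmem.mono fun q hq => hq.1) hint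
  have htail : ∀ q ∈ Icc (0:ℝ) 1, ν.real (Ici q) = 1 - ν.real (Icc 0 q) := by
    intro q hq
    have hIcc : ν.real (Icc 0 q) = ν.real (Iio q) := by
      refine measureReal_congr ?_
      filter_upwards [hmem, hne q] with x hx hxq
      refine propext ⟨fun h => lt_of_le_of_ne h.2 hxq, fun h => ⟨hx.1, le_of_lt h⟩⟩
    rw [hIcc, ← compl_Iio, probReal_compl_eq_one_sub measurableSet_Iio]
  have hF' : ∫ y, (∫ x in Icc 0 y, x ∂ν) ∂ν
      = ∫ q, q ∂ν - ∫ q, q * ν.real (Icc 0 q) ∂ν := by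
    rw [hF, ← integral_sub hint hintμ]
    refine integral_congr_ae ?_
    filter_upwards [hmem] with q hq
    rw [htail q hq]
    ring
  have hle : ∫ q, q * ν.real (Icc 0 q) / 2 ∂ν ≤ ∫ y, (∫ x in Icc 0 y, x ∂ν) ∂ν := by
    refine integral_mono_ae (hintμ.div_const 2) hintF ?_
    filter_upwards [hmem, hne 0, hne 1] with q hq hq0 hq1
    have := havg q ⟨lt_of_le_of_ne hq.1 hq0.symm, lt_of_le_of_ne hq.2 hq1⟩
    simpa only [mul_comm q] using this
  rw [integral_div, hF'] at hle
  have hm : 0 ≤ ∫ q, q ∂ν := integral_nonneg_of_ae (hmem.mono fun q hq => hq.1)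
  have hsq : (∫ q, q ∂ν) ^ 2 ≤ ∫ q, q ^ 2 ∂ν := by
    generalize hc : ∫ q, q ∂ν = c
    have hlin : Integrable (fun q : ℝ => 2 * c * q) ν := hint.const_mul _
    have h : ∫ q, (2 * c * q - c ^ 2) ∂ν ≤ ∫ q, q ^ 2 ∂ν :=
      integral_mono (hlin.sub (integrable_const _)) hint2 fun q => by
        nlinarith [sq_nonneg (q - c)]
    rw [integral_sub hlin (integrable_const _), integral_const_mul, hc, integral_const,
      probReal_univ, one_smul] at h
    linarith
  nlinarith [mul_le_mul_of_nonneg_left hle hm, sq_nonneg (∫ q, q ∂ν)]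
end

section
/- Let Q : [0,1] → [0,1] be measurable with Q(t) ≥ t for all t ∈ [0,1], and let m = ∫_0^1 Q(t) dt (so m ∈ [1/2, 1]). Set x = 1 − √(2m − 1). Then ∫_0^1 t·Q(t) dt ≤ x³/3 + (1 − x²)/2, with equality when Q(t) = t on [0,x] and Q(t) = 1 on (x,1]. -/
open MeasureTheory Set intervalIntegral

theorem integral_sub_const_mul_self (x : ℝ) :
    ∫ t in (0:ℝ)..x, (t - x) * t = -x ^ 3 / 6 := by
  have h : ∀ t : ℝ, (t - x) * t = t ^ 2 - x * t := fun t => by ring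
  simp only [h]
  rw [integral_sub (Continuous.intervalIntegrable (by fun_prop) _ _)
    (Continuous.intervalIntegrable (by fun_prop) _ _), integral_pow,
    intervalIntegral.integral_const_mul, integral_id]
  push_cast
  ring

theorem integral_id_sub_const (x : ℝ) :
    ∫ t in x..(1:ℝ), (t - x) = (1 - x) ^ 2 / 2 := by
  rw [integral_sub (Continuous.intervalIntegrable (by fun_prop) _ _)
    (Continuous.intervalIntegrable (by fun_prop) _ _), integral_id,
    intervalIntegral.integral_const, smul_eq_mul]
  ring

/-- Extremal step in the 1.36 price-of-anarchy bound: for measurable `Q : [0,1] → [0,1]`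
with `Q t ≥ t` and mean `m = ∫ Q` (so `m ∈ [1/2,1]`), setting `x = 1 - √(2m-1)` we have
`∫ t·Q t dt ≤ x³/3 + (1-x²)/2`, with equality when `Q = id` on `[0,x]` and `Q = 1` on
`(x,1]`. -/
theorem stmt_9
    (Q : ℝ → ℝ) (hQmeas : Measurable Q)
    (hQlb : ∀ t ∈ Set.Icc (0:ℝ) 1, t ≤ Q t)
    (hQub : ∀ t ∈ Set.Icc (0:ℝ) 1, Q t ≤ 1)
    (m : ℝ) (hm : m = ∫ t in (0:ℝ)..1, Q t)
    (x : ℝ) (hx : x = 1 - Real.sqrt (2 * m - 1)) :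
    m ∈ Set.Icc (1/2 : ℝ) 1 ∧
    (∫ t in (0:ℝ)..1, t * Q t) ≤ x ^ 3 / 3 + (1 - x ^ 2) / 2 ∧
    ((∀ t ∈ Set.Icc (0:ℝ) x, Q t = t) → (∀ t ∈ Set.Ioc x 1, Q t = 1) →
      (∫ t in (0:ℝ)..1, t * Q t) = x ^ 3 / 3 + (1 - x ^ 2) / 2) := by
  have hQint : IntervalIntegrable Q volume 0 1 := by
    rw [intervalIntegrable_iff_integrableOn_Icc_of_le zero_le_one]
    refine Measure.integrableOn_of_bounded (M := 1) (by simp) hQmeas.aestronglyMeasurable ?_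
    filter_upwards [ae_restrict_mem measurableSet_Icc] with t ht
    rw [Real.norm_eq_abs, abs_le]
    have := hQlb t ht
    exact ⟨by linarith [ht.1], hQub t ht⟩
  have hm_lower : 1 / 2 ≤ m := by
    have h := integral_mono_on zero_le_one
      (continuous_id.intervalIntegrable (μ := volume) (0:ℝ) 1) hQint hQlb
    simp only [id, integral_id] at h
    linarith
  have hm_upper : m ≤ 1 := by
    have h := integral_mono_on zero_le_one hQint
      (continuous_const.intervalIntegrable (μ := volume) (0:ℝ) 1) hQub
    simp only [intervalIntegral.integral_const, smul_eq_mul] at h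
    linarith
  have hx_one : x ≤ 1 := by linarith [Real.sqrt_nonneg (2 * m - 1)]
  have hx_zero : 0 ≤ x := by
    have : Real.sqrt (2 * m - 1) ≤ 1 := Real.sqrt_le_one.mpr (by linarith)
    linarith
  have hm_eq : m = x ^ 2 / 2 - x + 1 := by
    have := Real.sq_sqrt (show 0 ≤ 2 * m - 1 by linarith)
    rw [show Real.sqrt (2 * m - 1) = 1 - x by linarith] at this
    linarith
  have hQleft : IntervalIntegrable Q volume 0 x :=
    hQint.mono_set (by
      rw [uIcc_of_le hx_zero, uIcc_of_le zero_le_one]; exact Icc_subset_Icc le_rfl hx_one)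
  have hQright : IntervalIntegrable Q volume x 1 :=
    hQint.mono_set (by
      rw [uIcc_of_le hx_one, uIcc_of_le zero_le_one]; exact Icc_subset_Icc hx_zero le_rfl)
  have hcont : Continuous fun t : ℝ => t - x := by fun_prop
  have hleft : IntervalIntegrable (fun t => (t - x) * Q t) volume 0 x :=
    hQleft.continuousOn_mul hcont.continuousOn
  have hright : IntervalIntegrable (fun t => (t - x) * Q t) volume x 1 :=
    hQright.continuousOn_mul hcont.continuousOn
  have hsplit : (∫ t in (0:ℝ)..1, t * Q t) =
      (∫ t in (0:ℝ)..x, (t - x) * Q t) + (∫ t in x..(1:ℝ), (t - x) * Q t) + x * m := by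
    rw [integral_add_adjacent_intervals hleft hright, hm,
      ← intervalIntegral.integral_const_mul, ← integral_add (hleft.trans hright)
        (hQint.const_mul x)]
    congr 1
    ext t
    ring
  refine ⟨⟨hm_lower, hm_upper⟩, ?_, fun hQid hQone => ?_⟩
  · have hl : (∫ t in (0:ℝ)..x, (t - x) * Q t) ≤ ∫ t in (0:ℝ)..x, (t - x) * t :=
      integral_mono_on hx_zero hleft (Continuous.intervalIntegrable (by fun_prop) _ _)
        fun t ht => mul_le_mul_of_nonpos_left (hQlb t ⟨ht.1, ht.2.trans hx_one⟩)
          (sub_nonpos.mpr ht.2)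
    have hr : (∫ t in x..(1:ℝ), (t - x) * Q t) ≤ ∫ t in x..(1:ℝ), (t - x) :=
      integral_mono_on hx_one hright (hcont.intervalIntegrable _ _)
        fun t ht => mul_le_of_le_one_right (sub_nonneg.mpr ht.1)
          (hQub t ⟨hx_zero.trans ht.1, ht.2⟩)
    rw [integral_sub_const_mul_self] at hl
    rw [integral_id_sub_const] at hr
    rw [hsplit, hm_eq]
    linarith
  · have hl : (∫ t in (0:ℝ)..x, (t - x) * Q t) = ∫ t in (0:ℝ)..x, (t - x) * t :=
      integral_congr fun t ht => by
        rw [uIcc_of_le hx_zero] at ht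
        simp only [hQid t ht]
    have hr : (∫ t in x..(1:ℝ), (t - x) * Q t) = ∫ t in x..(1:ℝ), (t - x) :=
      integral_congr_ae <| Filter.Eventually.of_forall fun t ht => by
        rw [uIoc_of_le hx_one] at ht
        rw [hQone t ht, mul_one]
    rw [hsplit, hl, hr, integral_sub_const_mul_self, integral_id_sub_const, hm_eq]
    ring
end

section
/- Let α < β and 0 ≤ b ≤ c be real numbers, let Q : [α,β] → ℝ be integrable with b ≤ Q(t) ≤ c for all t ∈ [α,β], and let x ∈ [α,β] satisfy b·(x − α) + c·(β − x) = ∫_α^β Q(t) dt. Then ∫_α^β t·Q(t) dt ≤ b·(x² − α²)/2 + c·(β² − x²)/2. -/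
open MeasureTheory Set intervalIntegral

/-- If `(t - x) * Q t ≤ (t - x) * k` on `[p, q]`, then the first moment of `Q` about `x` is at most
that of the constant weight `k`. -/
theorem integral_id_mul_le_of_sub_mul_le {p q x k : ℝ} {Q : ℝ → ℝ} (hpq : p ≤ q)
    (hQ : IntervalIntegrable Q volume p q)
    (h : ∀ t ∈ Set.Icc p q, (t - x) * Q t ≤ (t - x) * k) :
    (∫ t in p..q, t * Q t) ≤
      x * (∫ t in p..q, Q t) + k * ((q ^ 2 - p ^ 2) / 2 - x * (q - p)) := by
  have hid : IntervalIntegrable (fun t => t * Q t) volume p q :=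
    hQ.continuousOn_mul continuousOn_id
  have hmono : (∫ t in p..q, (t * Q t - x * Q t)) ≤ ∫ t in p..q, (t - x) * k := by
    refine integral_mono_on hpq (hid.sub (hQ.const_mul x))
      (Continuous.intervalIntegrable (by fun_prop) _ _) fun t ht => ?_
    simpa only [sub_mul] using h t ht
  rw [integral_sub hid (hQ.const_mul x), intervalIntegral.integral_const_mul,
    intervalIntegral.integral_mul_const,
    integral_sub (Continuous.intervalIntegrable (by fun_prop) _ _) intervalIntegrable_const,
    integral_id, intervalIntegral.integral_const, smul_eq_mul] at hmono
  linarith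

/-- For fixed total weight `∫ Q`, the ability-weighted sum `∫ t·Q t dt` over `[α,β]`
with weights `Q t ∈ [b,c]` is maximized by the step assignment giving weight `b` on
`[α,x]` and weight `c` on `[x,β]`. -/
theorem stmt_10
    (α β b c : ℝ) (hαβ : α < β) (hb : 0 ≤ b) (hbc : b ≤ c)
    (Q : ℝ → ℝ) (hQint : IntervalIntegrable Q volume α β)
    (hQlb : ∀ t ∈ Set.Icc α β, b ≤ Q t)
    (hQub : ∀ t ∈ Set.Icc α β, Q t ≤ c)
    (x : ℝ) (hxmem : x ∈ Set.Icc α β)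
    (hx : b * (x - α) + c * (β - x) = ∫ t in α..β, Q t) :
    (∫ t in α..β, t * Q t) ≤ b * (x ^ 2 - α ^ 2) / 2 + c * (β ^ 2 - x ^ 2) / 2 := by
  obtain ⟨hαx, hxβ⟩ := hxmem
  have hQl : IntervalIntegrable Q volume α x :=
    hQint.mono_set (uIcc_subset_uIcc_left (mem_uIcc_of_le hαx hxβ))
  have hQr : IntervalIntegrable Q volume x β :=
    hQint.mono_set (uIcc_subset_uIcc_right (mem_uIcc_of_le hαx hxβ))
  have hl := integral_id_mul_le_of_sub_mul_le (x := x) (k := b) hαx hQl fun t ht =>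
    mul_le_mul_of_nonpos_left (hQlb t ⟨ht.1, ht.2.trans hxβ⟩) (sub_nonpos.2 ht.2)
  have hr := integral_id_mul_le_of_sub_mul_le (x := x) (k := c) hxβ hQr fun t ht =>
    mul_le_mul_of_nonneg_left (hQub t ⟨hαx.trans ht.1, ht.2⟩) (sub_nonneg.2 ht.1)
  rw [← integral_add_adjacent_intervals hQl hQr] at hx
  rw [← integral_add_adjacent_intervals (hQl.continuousOn_mul (continuousOn_id' _))
    (hQr.continuousOn_mul (continuousOn_id' _))]
  linear_combination hl + hr - x * hx
end

section
/- Let 0 ≤ a ≤ 1/2, let 0 ≤ b and c ≤ 2b be real numbers, and let Q : [a, 1−a] → ℝ be measurable with b ≤ Q(t) ≤ c for all t ∈ [a, 1−a]. Then ∫_a^{1−a} t·Q(t) dt ≤ (4/3)·(1/2)·∫_a^{1−a} Q(t) dt. -/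
open MeasureTheory Set intervalIntegral

/-- Pointwise bound whose correction term is odd about `1/2`, hence integrates to zero over any
interval symmetric about `1/2`. -/
lemma mul_le_two_thirds_mul_add {t q b : ℝ} (ht0 : 0 ≤ t) (ht1 : t ≤ 1) (hb : 0 ≤ b)
    (hbq : b ≤ q) (hqb : q ≤ 2 * b) :
    t * q ≤ 2 / 3 * q + 4 / 3 * b * (t - 1 / 2) := by
  rcases le_total t (2 / 3) with h | h
  · nlinarith [mul_nonneg (sub_nonneg.2 h) (sub_nonneg.2 hbq), mul_nonneg ht0 hb]
  · nlinarith [mul_nonneg (sub_nonneg.2 h) (sub_nonneg.2 hqb), mul_nonneg (sub_nonneg.2 ht1) hb]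

/-- Middle-interval bound in the 4/3 price-of-anarchy analysis: jobs with qualities
`Q t ∈ [b,c]`, `c ≤ 2b`, matched to the symmetric ability interval `[a, 1-a]` satisfy
`∫ t·Q t dt ≤ (4/3)·(1/2)·∫ Q t dt` (each early job is matched to an average,
ability-1/2, student at equilibrium). -/
theorem stmt_11
    (a b c : ℝ) (ha0 : 0 ≤ a) (ha : a ≤ 1/2) (hb : 0 ≤ b) (hc : c ≤ 2 * b)
    (Q : ℝ → ℝ) (hQmeas : Measurable Q)
    (hQlb : ∀ t ∈ Set.Icc a (1 - a), b ≤ Q t)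
    (hQub : ∀ t ∈ Set.Icc a (1 - a), Q t ≤ c) :
    (∫ t in a..(1 - a), t * Q t) ≤ 4/3 * (1/2 * ∫ t in a..(1 - a), Q t) := by
  have hle : a ≤ 1 - a := by linarith
  have hQ : IntervalIntegrable Q volume a (1 - a) := by
    rw [intervalIntegrable_iff_integrableOn_Icc_of_le hle]
    refine IntegrableOn.of_bound measure_Icc_lt_top hQmeas.aestronglyMeasurable c ?_
    filter_upwards [ae_restrict_mem measurableSet_Icc] with t ht
    rw [Real.norm_eq_abs, abs_of_nonneg (hb.trans (hQlb t ht))]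
    exact hQub t ht
  have hodd : IntervalIntegrable (fun t : ℝ => 4 / 3 * b * (t - 1 / 2)) volume a (1 - a) :=
    Continuous.intervalIntegrable (by fun_prop) _ _
  have hzero : ∫ t in a..(1 - a), 4 / 3 * b * (t - 1 / 2) = 0 := by
    rw [intervalIntegral.integral_const_mul, intervalIntegral.integral_sub (by simp) (by simp),
      integral_id, intervalIntegral.integral_const, smul_eq_mul]
    ring
  calc (∫ t in a..(1 - a), t * Q t)
      ≤ ∫ t in a..(1 - a), (2 / 3 * Q t + 4 / 3 * b * (t - 1 / 2)) := by
        refine intervalIntegral.integral_mono_on hle (hQ.continuousOn_mul continuousOn_id)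
          ((hQ.const_mul _).add hodd) fun t ht => ?_
        exact mul_le_two_thirds_mul_add (ha0.trans ht.1) (by linarith [ht.2]) hb (hQlb t ht)
          ((hQub t ht).trans hc)
    _ = 4/3 * (1/2 * ∫ t in a..(1 - a), Q t) := by
        rw [intervalIntegral.integral_add (hQ.const_mul _) hodd, hzero,
          intervalIntegral.integral_const_mul]
        ring
end

section
/- Let 0 < a ≤ 1/2 and let Q : [1−a, 1] → ℝ be nonnegative and nondecreasing. Then ∫_{1−a}^1 t·Q(t) dt ≤ (4/3)·∫_{1−a}^1 (1 − (1−t)/(2a))·Q(t) dt. -/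
/-- If `g` changes sign from nonpositive to nonnegative at `c`, and `Q` is monotone, then
`g * Q` dominates `g * Q c`; hence `∫ g * Q ≥ Q c * ∫ g`. -/
theorem mul_integral_le_integral_mul_of_monotoneOn {x y c : ℝ} (hxy : x ≤ y)
    {g Q : ℝ → ℝ} (hg : Continuous g) (hQ : MonotoneOn Q (Set.Icc x y))
    (hc : c ∈ Set.Icc x y)
    (hneg : ∀ t ∈ Set.Icc x y, t < c → g t ≤ 0)
    (hpos : ∀ t ∈ Set.Icc x y, c ≤ t → 0 ≤ g t) :
    Q c * (∫ t in x..y, g t) ≤ ∫ t in x..y, g t * Q t := by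
  have hQi : IntervalIntegrable Q MeasureTheory.volume x y :=
    MonotoneOn.intervalIntegrable (by rwa [Set.uIcc_of_le hxy])
  rw [← intervalIntegral.integral_const_mul]
  refine intervalIntegral.integral_mono_on hxy ((hg.intervalIntegrable x y).const_mul _)
    (hQi.continuousOn_mul hg.continuousOn) fun t ht => ?_
  rw [mul_comm (Q c)]
  rcases le_or_gt c t with h | h
  · exact mul_le_mul_of_nonneg_left (hQ hc ht h) (hpos t ht h)
  · exact mul_le_mul_of_nonpos_left (hQ ht hc h.le) (hneg t ht h)

open MeasureTheory Set intervalIntegral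

/-- Top-interval bound in the 4/3 price-of-anarchy analysis: for `Q` nonnegative and
nondecreasing on `[1-a, 1]` (the truthful mapping on the top student interval), the
optimal welfare `∫ t·Q t dt` is at most `4/3` times the equilibrium welfare
`∫ (1 - (1-t)/(2a))·Q t dt`, where the top students are stretched onto `[1/2,1]`. -/
theorem stmt_12
    (a : ℝ) (ha0 : 0 < a) (ha : a ≤ 1/2)
    (Q : ℝ → ℝ)
    (hQ0 : ∀ t ∈ Set.Icc (1 - a) 1, 0 ≤ Q t)
    (hQmono : MonotoneOn Q (Set.Icc (1 - a) 1)) :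
    (∫ t in (1 - a)..1, t * Q t) ≤
      4/3 * ∫ t in (1 - a)..1, (1 - (1 - t) / (2 * a)) * Q t := by
  have hQi : IntervalIntegrable Q volume (1 - a) 1 :=
    MonotoneOn.intervalIntegrable (by rwa [uIcc_of_le (by linarith)])
  have h1 : IntervalIntegrable (fun t => t * Q t) volume (1 - a) 1 :=
    hQi.continuousOn_mul continuousOn_id
  have h2 : IntervalIntegrable (fun t => (1 - (1 - t) / (2 * a)) * Q t) volume (1 - a) 1 :=
    hQi.continuousOn_mul (by fun_prop)
  set k : ℝ := 2 / (3 * a) - 1 with hk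
  have hka : k * a = 2 / 3 - a := by rw [hk]; field_simp
  have hkpos : 0 < k := pos_of_mul_pos_left (by rw [hka]; linarith) ha0.le
  rw [← sub_nonneg, ← intervalIntegral.integral_const_mul,
    ← intervalIntegral.integral_sub (h2.const_mul _) h1]
  have hfun : (fun t => 4 / 3 * ((1 - (1 - t) / (2 * a)) * Q t) - t * Q t) =
      fun t => (1 / 3 - (1 - t) * k) * Q t := by
    funext t
    rw [hk]
    field_simp
    ring
  rw [hfun]
  have hint : ∫ t in (1 - a)..1, (1 / 3 - (1 - t) * k) = a ^ 2 / 2 := by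
    have : (fun t : ℝ => 1 / 3 - (1 - t) * k) = fun t => (1 / 3 - k) + k * t := by
      funext t; ring
    rw [this, intervalIntegral.integral_add (by simp)
      (Continuous.intervalIntegrable (by fun_prop) _ _), intervalIntegral.integral_const_mul,
      _root_.integral_id,
      intervalIntegral.integral_const, smul_eq_mul]
    linear_combination (-a / 2) * hka
  have hc : max (1 - a) (1 - 1 / (3 * k)) ∈ Icc (1 - a) 1 :=
    ⟨le_max_left _ _, max_le (by linarith) (by
      have : 0 < 1 / (3 * k) := by positivity
      linarith)⟩
  have hroot : 1 / (3 * k) * k = 1 / 3 := by field_simp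
  have key := mul_integral_le_integral_mul_of_monotoneOn (by linarith)
    (g := fun t => 1 / 3 - (1 - t) * k) (by fun_prop) hQmono hc
    (fun t ht htc => by
      have : t < 1 - 1 / (3 * k) := by
        rcases lt_max_iff.1 htc with h | h
        · exact absurd ht.1 (not_le.2 h)
        · exact h
      nlinarith)
    (fun t _ htc => by
      have := (max_le_iff.1 htc).2
      nlinarith)
  rw [hint] at key
  exact (mul_nonneg (hQ0 _ hc) (by positivity)).trans key
end
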